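/- Let E : M_d → M_d be a unital quantum channel with d ≥ 2. Then the multiplicative index satisfies κ(E) ≤ 2d − 2. -/

import Mathlib

open scoped Kronecker ComplexOrder

noncomputable section

/-- The amplification `1_n ⊗ E` of a linear map on matrices, acting on `M_n ⊗ M_ι`. -/
def ampl {ι : Type*} [Fintype ι] (n : ℕ)
    (E : Module.End ℂ (Matrix ι ι ℂ))
    (A : Matrix (Fin n × ι) (Fin n × ι) ℂ) :
    Matrix (Fin n × ι) (Fin n × ι) ℂ :=
  Matrix.of fun p q => E (Matrix.of fun a b => A (p.1, a) (q.1, b)) p.2 q.2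

/-- A quantum channel: completely positive (every amplification preserves positive
semidefiniteness) and trace preserving. -/
def IsQuantumChannel {ι : Type*} [Fintype ι] (E : Module.End ℂ (Matrix ι ι ℂ)) : Prop :=
  (∀ (n : ℕ) (A : Matrix (Fin n × ι) (Fin n × ι) ℂ),
      A.PosSemidef → (ampl n E A).PosSemidef) ∧
    ∀ x : Matrix ι ι ℂ, (E x).trace = x.trace

/-- The multiplicative domain of a linear map on a matrix algebra. -/
def multDomain {ι : Type*} [Fintype ι] (E : Module.End ℂ (Matrix ι ι ℂ)) :
    Set (Matrix ι ι ℂ) :=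
  {x | ∀ y, E (x * y) = E x * E y ∧ E (y * x) = E y * E x}

/-- The multiplicative index: the least `n ≥ 1` from which the chain of multiplicative
domains of the powers of `E` has stabilized. -/
def multIndex {ι : Type*} [Fintype ι] (E : Module.End ℂ (Matrix ι ι ℂ)) : ℕ :=
  sInf {n | 0 < n ∧ ∀ m, n ≤ m → multDomain (E ^ m) = multDomain (E ^ n)}

/-- The stabilized multiplicative domain `M_{E^∞}`. -/
def stabMultDomain {ι : Type*} [Fintype ι] (E : Module.End ℂ (Matrix ι ι ℂ)) :
    Set (Matrix ι ι ℂ) :=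
  ⋂ (n : ℕ) (_ : 0 < n), multDomain (E ^ n)

section StarSubalgebras

open scoped Matrix

universe u

variable {ι : Type u} [Fintype ι] [DecidableEq ι]

/-- A self-adjoint space of pairwise commuting matrices inside the star subalgebra `A`. -/
structure IsAbelianIn (A : StarSubalgebra ℂ (Matrix ι ι ℂ)) (S : Submodule ℂ (Matrix ι ι ℂ)) :
    Prop where
  mem : ∀ x ∈ S, x ∈ A
  comm : ∀ x ∈ S, ∀ y ∈ S, x * y = y * x
  star_closed : ∀ x ∈ S, star x ∈ S

/-- The largest dimension of a self-adjoint commuting space of matrices in `A`. -/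
def abelianRank (A : StarSubalgebra ℂ (Matrix ι ι ℂ)) : ℕ :=
  sSup {k | ∃ S, IsAbelianIn A S ∧ Module.finrank ℂ S = k}

/-- The center of a star subalgebra, as a space of matrices. -/
def centerIn (A : StarSubalgebra ℂ (Matrix ι ι ℂ)) : Submodule ℂ (Matrix ι ι ℂ) :=
  A.toSubalgebra.toSubmodule ⊓
    (Subalgebra.centralizer ℂ (A : Set (Matrix ι ι ℂ))).toSubmodule

variable {A B : StarSubalgebra ℂ (Matrix ι ι ℂ)} {S T : Submodule ℂ (Matrix ι ι ℂ)}

theorem mem_centerIn {x : Matrix ι ι ℂ} :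
    x ∈ centerIn A ↔ x ∈ A ∧ ∀ y ∈ A, y * x = x * y := by
  simp [centerIn, Subalgebra.mem_centralizer_iff]

theorem IsAbelianIn.mono (hAB : B ≤ A) (hS : IsAbelianIn B S) : IsAbelianIn A S :=
  ⟨fun x hx => hAB (hS.mem x hx), hS.comm, hS.star_closed⟩

theorem IsAbelianIn.bot : IsAbelianIn A ⊥ := by
  constructor <;> simp +contextual

theorem IsAbelianIn.sup (hS : IsAbelianIn A S) (hT : IsAbelianIn A T)
    (hST : ∀ x ∈ S, ∀ y ∈ T, x * y = y * x) : IsAbelianIn A (S ⊔ T) := by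
  refine ⟨fun x hx => ?_, fun x hx y hy => ?_, fun x hx => ?_⟩
  · obtain ⟨s, hs, t, ht, rfl⟩ := Submodule.mem_sup.1 hx
    exact add_mem (hS.mem s hs) (hT.mem t ht)
  · obtain ⟨s, hs, t, ht, rfl⟩ := Submodule.mem_sup.1 hx
    obtain ⟨s', hs', t', ht', rfl⟩ := Submodule.mem_sup.1 hy
    simp only [mul_add, add_mul, hS.comm s hs s' hs', hT.comm t ht t' ht',
      hST s hs t' ht', hST s' hs' t ht]
    abel
  · obtain ⟨s, hs, t, ht, rfl⟩ := Submodule.mem_sup.1 hx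
    rw [star_add]
    exact Submodule.add_mem_sup (hS.star_closed s hs) (hT.star_closed t ht)

theorem bddAbove_finrank_isAbelianIn (A : StarSubalgebra ℂ (Matrix ι ι ℂ)) :
    BddAbove {k | ∃ S, IsAbelianIn A S ∧ Module.finrank ℂ S = k} := by
  refine ⟨Module.finrank ℂ (Matrix ι ι ℂ), ?_⟩
  rintro _ ⟨S, -, rfl⟩
  exact S.finrank_le

theorem IsAbelianIn.finrank_le (hS : IsAbelianIn A S) :
    Module.finrank ℂ S ≤ abelianRank A :=
  le_csSup (bddAbove_finrank_isAbelianIn A) ⟨S, hS, rfl⟩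

theorem exists_finrank_eq_abelianRank (A : StarSubalgebra ℂ (Matrix ι ι ℂ)) :
    ∃ S, IsAbelianIn A S ∧ Module.finrank ℂ S = abelianRank A :=
  Nat.sSup_mem (s := {k | ∃ S, IsAbelianIn A S ∧ Module.finrank ℂ S = k})
    ⟨_, ⊥, IsAbelianIn.bot, rfl⟩ (bddAbove_finrank_isAbelianIn A)

theorem isAbelianIn_centerIn (A : StarSubalgebra ℂ (Matrix ι ι ℂ)) :
    IsAbelianIn A (centerIn A) := by
  refine ⟨fun x hx => (mem_centerIn.1 hx).1,
    fun x hx y hy => (mem_centerIn.1 hy).2 x (mem_centerIn.1 hx).1, fun x hx => ?_⟩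
  rw [mem_centerIn] at hx ⊢
  refine ⟨star_mem hx.1, fun y hy => ?_⟩
  simpa using congrArg star (hx.2 (star y) (star_mem hy)).symm

theorem abelianRank_mono (hAB : B ≤ A) : abelianRank B ≤ abelianRank A := by
  obtain ⟨S, hS, hrank⟩ := exists_finrank_eq_abelianRank B
  exact hrank ▸ (hS.mono hAB).finrank_le

theorem IsAbelianIn.sup_centerIn (hS : IsAbelianIn A S) : IsAbelianIn A (S ⊔ centerIn A) :=
  hS.sup (isAbelianIn_centerIn A) fun x hx _ hy =>
    (mem_centerIn.1 hy).2 x (hS.mem x hx)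

theorem abelianRank_add_finrank_centerIn_le (hAB : B ≤ A) :
    abelianRank B + Module.finrank ℂ (centerIn A) ≤
      abelianRank A + Module.finrank ℂ (centerIn B) := by
  obtain ⟨S, hS, hrank⟩ := exists_finrank_eq_abelianRank B
  have hinf : S ⊓ centerIn A ≤ centerIn B := fun x hx =>
    mem_centerIn.2 ⟨hS.mem x hx.1, fun y hy => (mem_centerIn.1 hx.2).2 y (hAB hy)⟩
  rw [← hrank, ← Submodule.finrank_sup_add_finrank_inf_eq]
  exact add_le_add (hS.mono hAB).sup_centerIn.finrank_le (Submodule.finrank_mono hinf)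

theorem IsAbelianIn.le_of_commute (hS : IsAbelianIn A S)
    (hrank : abelianRank A ≤ Module.finrank ℂ S) (hT : IsAbelianIn A T)
    (hST : ∀ x ∈ S, ∀ y ∈ T, x * y = y * x) : T ≤ S := by
  have h := Submodule.eq_of_le_of_finrank_le (le_sup_left : S ≤ S ⊔ T)
    ((hS.sup hT hST).finrank_le.trans hrank)
  exact h ▸ le_sup_right

theorem IsAbelianIn.mem_of_commute (hS : IsAbelianIn A S)
    (hrank : abelianRank A ≤ Module.finrank ℂ S) {y : Matrix ι ι ℂ} (hy : y ∈ A)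
    (hyS : ∀ x ∈ S, x * y = y * x) : y ∈ S := by
  have selfAdjoint_mem : ∀ z ∈ A, star z = z → (∀ x ∈ S, x * z = z * x) → z ∈ S := by
    intro z hz hstar hcomm
    refine hS.le_of_commute hrank (T := ℂ ∙ z) ?_ ?_ (Submodule.mem_span_singleton_self z)
    · refine ⟨fun x hx => ?_, fun x hx x' hx' => ?_, fun x hx => ?_⟩
      · obtain ⟨c, rfl⟩ := Submodule.mem_span_singleton.1 hx
        exact SMulMemClass.smul_mem c hz
      · obtain ⟨c, rfl⟩ := Submodule.mem_span_singleton.1 hx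
        obtain ⟨c', rfl⟩ := Submodule.mem_span_singleton.1 hx'
        simp [smul_smul, mul_comm]
      · obtain ⟨c, rfl⟩ := Submodule.mem_span_singleton.1 hx
        rw [star_smul, hstar]
        exact Submodule.smul_mem _ _ (Submodule.mem_span_singleton_self z)
    · intro x hx x' hx'
      obtain ⟨c, rfl⟩ := Submodule.mem_span_singleton.1 hx'
      simp [hcomm x hx]
  have hyS' : ∀ x ∈ S, x * star y = star y * x := fun x hx => by
    simpa using congrArg star (hyS (star x) (hS.star_closed x hx)).symm
  have hre : y + star y ∈ S := selfAdjoint_mem _ (add_mem hy (star_mem hy))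
    (by simp [add_comm]) fun x hx => by rw [mul_add, add_mul, hyS x hx, hyS' x hx]
  have him : Complex.I • (y - star y) ∈ S := selfAdjoint_mem _
    (SMulMemClass.smul_mem _ (sub_mem hy (star_mem hy)))
    (by simp [star_smul, sub_eq_add_neg, add_comm])
    fun x hx => by simp [mul_sub, sub_mul, hyS x hx, hyS' x hx]
  have hdecomp : y = (1 / 2 : ℂ) • ((y + star y) + (-Complex.I) • (Complex.I • (y - star y))) := by
    rw [smul_smul, neg_mul, Complex.I_mul_I, neg_neg, one_smul, add_add_sub_cancel, ← two_smul ℂ,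
      smul_smul]
    norm_num
  rw [hdecomp]
  exact S.smul_mem _ (S.add_mem hre (S.smul_mem _ him))

theorem IsAbelianIn.one_mem_of_le_finrank (hS : IsAbelianIn A S)
    (hrank : abelianRank A ≤ Module.finrank ℂ S) : (1 : Matrix ι ι ℂ) ∈ S :=
  hS.mem_of_commute hrank (one_mem A) (by simp)

theorem IsAbelianIn.mul_mem_of_le_finrank (hS : IsAbelianIn A S)
    (hrank : abelianRank A ≤ Module.finrank ℂ S) {x y : Matrix ι ι ℂ} (hx : x ∈ S) (hy : y ∈ S) :
    x * y ∈ S :=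
  hS.mem_of_commute hrank (mul_mem (hS.mem x hx) (hS.mem y hy))
    fun z hz => by
      rw [← mul_assoc, hS.comm z hz x hx, mul_assoc, hS.comm z hz y hy, mul_assoc]

/-- A commutative self-adjoint algebra of matrices is spanned by orthogonal projections. -/
theorem exists_orthogonal_projections (C : Subalgebra ℂ (Matrix ι ι ℂ))
    (hcomm : ∀ x ∈ C, ∀ y ∈ C, x * y = y * x) (hstar : ∀ x ∈ C, star x ∈ C) :
    ∃ (I : Type u) (_ : Fintype I) (e : I → Matrix ι ι ℂ),
      CompleteOrthogonalIdempotents e ∧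
      (∀ i, e i ∈ C) ∧ (∀ i, e i ≠ 0) ∧ (∀ i, star (e i) = e i) ∧
      ∀ c ∈ C, ∀ i, ∃ r : ℂ, c * e i = r • e i := by
  classical
  let _ : CommRing C := { mul_comm := fun x y => Subtype.ext (hcomm x x.2 y y.2) }
  have hsq : ∀ x ∈ C, x * x = 0 → x = 0 := by
    intro x hx h
    have h1 : star (star x * x) * (star x * x) = 0 := by
      rw [star_mul, star_star, mul_assoc, ← mul_assoc x, hcomm x hx _ (hstar x hx), mul_assoc,
        h, mul_zero, mul_zero]
    exact Matrix.conjTranspose_mul_self_eq_zero.1 (Matrix.conjTranspose_mul_self_eq_zero.1 h1)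
  have hred : IsReduced C := (isReduced_iff_pow_one_lt 2 one_lt_two).2 fun x hx =>
    Subtype.ext (hsq x x.2 (by simpa [pow_two] using congrArg Subtype.val hx))
  have hart : IsArtinianRing C := IsArtinianRing.of_finite ℂ C
  let f := IsArtinianRing.equivPi C
  have : Fintype (MaximalSpectrum C) := Fintype.ofFinite _
  let e : MaximalSpectrum C → C := fun i => f.symm (Pi.single i 1)
  have he : CompleteOrthogonalIdempotents e :=
    (CompleteOrthogonalIdempotents.single fun I : MaximalSpectrum C => C ⧸ I.asIdeal).map
      f.symm.toRingEquiv.toRingHom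
  refine ⟨MaximalSpectrum C, inferInstance, fun i => (e i : Matrix ι ι ℂ),
    he.map C.val.toRingHom, fun i => (e i).2, fun i h => ?_, fun i => ?_, fun c hc i => ?_⟩
  · have h0 : f.symm (Pi.single i 1) = 0 := Subtype.ext h
    have h1 := congrFun ((map_eq_zero_iff f.symm f.symm.injective).1 h0) i
    have := i.isMaximal
    simp at h1
  · change star (e i : Matrix ι ι ℂ) = e i
    have hi : (e i : Matrix ι ι ℂ) * e i = e i := congrArg Subtype.val (he.idem i)
    generalize hp : (e i : Matrix ι ι ℂ) = p at hi ⊢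
    have hpC : p ∈ C := hp ▸ (e i).2
    have h0 : star (p - star p * p) * (p - star p * p) = 0 := by
      have hcp : p * (star p * p) = star p * p := by
        rw [← mul_assoc, hcomm p hpC _ (hstar p hpC), mul_assoc, hi]
      rw [star_sub, star_mul, star_star, sub_mul, mul_sub, mul_sub, mul_assoc (star p) p p, hi,
        mul_assoc (star p) p, hcp, sub_self]
    have h1 : p = star p * p := sub_eq_zero.1 (Matrix.conjTranspose_mul_self_eq_zero.1 h0)
    rw [h1, star_mul, star_star]
  · obtain ⟨r, hr⟩ : ∃ r : ℂ, algebraMap ℂ (C ⧸ i.asIdeal) r = Ideal.Quotient.mk _ ⟨c, hc⟩ := by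
      have := i.isMaximal
      exact (IsAlgClosed.algebraMap_bijective_of_isIntegral).2 _
    refine ⟨r, ?_⟩
    have h : (⟨c, hc⟩ : C) * e i = r • e i := by
      apply f.injective
      ext j
      have hfe : f (e i) = Pi.single i 1 := f.apply_symm_apply _
      have hsmul : r • e i = algebraMap ℂ C r * e i := Algebra.smul_def r (e i)
      rw [hsmul, map_mul, map_mul, hfe, Pi.mul_apply, Pi.mul_apply]
      rcases eq_or_ne j i with rfl | hj
      · rw [Pi.single_eq_same, mul_one, mul_one]
        exact hr.symm
      · rw [Pi.single_eq_of_ne hj, mul_zero, mul_zero]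
    exact congrArg Subtype.val h

theorem card_le_of_orthogonalIdempotents {I : Type*} [Fintype I] {e : I → Matrix ι ι ℂ}
    (he : OrthogonalIdempotents e) (h0 : ∀ i, e i ≠ 0) : Fintype.card I ≤ Fintype.card ι := by
  classical
  have hcol : ∀ i, ∃ v : ι → ℂ, e i *ᵥ v ≠ 0 := by
    intro i
    by_contra! h
    exact h0 i (Matrix.ext_of_mulVec_single fun j => by rw [h, Matrix.zero_mulVec])
  choose v hv using hcol
  have hli : LinearIndependent ℂ fun i => e i *ᵥ v i := by
    rw [Fintype.linearIndependent_iff]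
    intro g hg i
    have h1 := congrArg (e i *ᵥ ·) hg
    simp only [Matrix.mulVec_sum, Matrix.mulVec_smul, Matrix.mulVec_mulVec, he.mul_eq,
      Matrix.mulVec_zero] at h1
    rw [Finset.sum_eq_single i (fun j _ hj => by simp [hj.symm]) (by simp)] at h1
    simpa [hv i] using h1
  simpa using hli.fintype_card_le_finrank

theorem abelianRank_le_card (A : StarSubalgebra ℂ (Matrix ι ι ℂ)) :
    abelianRank A ≤ Fintype.card ι := by
  obtain ⟨S, hS, hrank⟩ := exists_finrank_eq_abelianRank A
  obtain ⟨I, _, e, he, -, he0, -, heS⟩ := exists_orthogonal_projections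
    (S.toSubalgebra (hS.one_mem_of_le_finrank hrank.ge)
      fun x y hx hy => hS.mul_mem_of_le_finrank hrank.ge hx hy) hS.comm hS.star_closed
  have hspan : S ≤ Submodule.span ℂ (Set.range e) := by
    intro c hc
    rw [← mul_one c, ← he.complete, Finset.mul_sum]
    refine Submodule.sum_mem _ fun i _ => ?_
    obtain ⟨r, hr⟩ := heS c hc i
    exact hr ▸ Submodule.smul_mem _ _ (Submodule.subset_span ⟨i, rfl⟩)
  rw [← hrank]
  exact (Submodule.finrank_mono hspan).trans ((finrank_range_le_card e).trans
    (card_le_of_orthogonalIdempotents he.toOrthogonalIdempotents he0))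

theorem finrank_centerIn_pos [Nonempty ι] (A : StarSubalgebra ℂ (Matrix ι ι ℂ)) :
    0 < Module.finrank ℂ (centerIn A) := by
  have h1 : (1 : Matrix ι ι ℂ) ∈ centerIn A := mem_centerIn.2 ⟨one_mem A, by simp⟩
  exact Module.finrank_pos_iff_exists_ne_zero.2
    ⟨⟨1, h1⟩, fun h => one_ne_zero (congrArg Subtype.val h)⟩

theorem eq_of_abelianRank_le_of_finrank_centerIn_le (hBA : B ≤ A)
    (hrank : abelianRank A ≤ abelianRank B)
    (hcenter : Module.finrank ℂ (centerIn B) ≤ Module.finrank ℂ (centerIn A)) : B = A := by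
  classical
  obtain ⟨S, hS, hSrank⟩ := exists_finrank_eq_abelianRank B
  have hSA := hS.mono hBA
  have hle : abelianRank A ≤ Module.finrank ℂ S := hSrank ▸ hrank
  have hZS : centerIn A ≤ S := hSA.le_of_commute hle (isAbelianIn_centerIn A) fun x hx y hy =>
    (mem_centerIn.1 hy).2 x (hSA.mem x hx)
  have hZ : centerIn A = centerIn B := Submodule.eq_of_le_of_finrank_le (fun x hx =>
    mem_centerIn.2 ⟨hS.mem x (hZS hx), fun y hy => (mem_centerIn.1 hx).2 y (hBA hy)⟩) hcenter
  obtain ⟨I, _, e, he, heS, he0, hestar, hscalar⟩ := exists_orthogonal_projections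
    (S.toSubalgebra (hS.one_mem_of_le_finrank hSrank.ge)
      fun x y hx hy => hS.mul_mem_of_le_finrank hSrank.ge hx hy) hS.comm hS.star_closed
  have heB : ∀ i, e i ∈ B := fun i => hS.mem _ (heS i)
  have hidem : ∀ i, e i * e i = e i := he.idem
  have hcorner : ∀ i, ∀ a ∈ A, e i * a = a → a * e i = a → ∃ r : ℂ, a = r • e i := by
    intro i a ha h1 h2
    have haS : a ∈ S := by
      refine hSA.mem_of_commute hle ha fun x hx => ?_
      obtain ⟨r, hr⟩ := hscalar x hx i
      have hr' : e i * x = r • e i := by rw [← hr, hS.comm x hx _ (heS i)]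
      calc x * a = x * e i * a := by rw [mul_assoc, h1]
        _ = a * (e i * x) := by rw [hr, hr', smul_mul_assoc, mul_smul_comm, h1, h2]
        _ = a * x := by rw [← mul_assoc, h2]
    obtain ⟨r, hr⟩ := hscalar a haS i
    exact ⟨r, h2 ▸ hr⟩
  let link : I → I → Prop := fun i j => ∃ b ∈ B, e i * b = b ∧ b * e j = b ∧ b ≠ 0
  have star_left : ∀ {i b}, b * e i = b → e i * star b = star b := fun {i b} h => by
    simpa [hestar i] using congrArg star h
  have star_right : ∀ {i b}, e i * b = b → star b * e i = star b := fun {i b} h => by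
    simpa [hestar i] using congrArg star h
  have hnorm : ∀ j, ∀ b ∈ B, b * e j = b → b ≠ 0 → ∃ r : ℂ, r ≠ 0 ∧ star b * b = r • e j := by
    intro j b hb h2 hb0
    obtain ⟨r, hr⟩ := hcorner j (star b * b) (hBA (mul_mem (star_mem hb) hb))
      (by rw [← mul_assoc, star_left h2]) (by rw [mul_assoc, h2])
    refine ⟨r, fun h0 => hb0 ?_, hr⟩
    rw [h0, zero_smul] at hr
    exact Matrix.conjTranspose_mul_self_eq_zero.1 hr
  have link_symm : ∀ {i j}, link i j → link j i := by
    rintro i j ⟨b, hb, h1, h2, hb0⟩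
    exact ⟨star b, star_mem hb, star_left h2, star_right h1, star_ne_zero.2 hb0⟩
  have link_trans : ∀ {i j k}, link i j → link j k → link i k := by
    rintro i j k ⟨b, hb, h1, h2, hb0⟩ ⟨c, hc, h3, h4, hc0⟩
    refine ⟨b * c, mul_mem hb hc, by rw [← mul_assoc, h1], by rw [mul_assoc, h4], fun h => ?_⟩
    obtain ⟨r, hr0, hr⟩ := hnorm j b hb h2 hb0
    have h5 : r • c = 0 := by
      rw [← h3, ← smul_mul_assoc, ← hr, mul_assoc, h, mul_zero]
    exact (smul_ne_zero hr0 hc0) h5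
  have link_refl : ∀ i, link i i := fun i => ⟨e i, heB i, hidem i, hidem i, he0 i⟩
  have hpiece : ∀ x ∈ A, ∀ i j, e i * x * e j ∈ B := by
    intro x hx i j
    set y := e i * x * e j with hy
    have hyA : y ∈ A := mul_mem (mul_mem (hBA (heB i)) hx) (hBA (heB j))
    have hy1 : e i * y = y := by simp only [hy, ← mul_assoc, hidem]
    have hy2 : y * e j = y := by simp only [hy, mul_assoc, hidem]
    by_cases hij : link i j
    · obtain ⟨b, hb, h1, h2, hb0⟩ := hij
      obtain ⟨r, hr0, hr⟩ := hnorm j b hb h2 hb0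
      obtain ⟨s, hs⟩ := hcorner i (y * star b) (mul_mem hyA (star_mem (hBA hb)))
        (by rw [← mul_assoc, hy1]) (by rw [mul_assoc, star_right h1])
      have h3 : r • y = s • b := by
        rw [← hy2, ← mul_smul_comm, ← hr, ← mul_assoc, hs, smul_mul_assoc, h1]
      rw [← inv_smul_smul₀ hr0 y, h3]
      exact SMulMemClass.smul_mem _ (SMulMemClass.smul_mem _ hb)
    · let z : Matrix ι ι ℂ := ∑ k, if link i k then e k else 0
      have hze : ∀ k, z * e k = if link i k then e k else 0 := by
        intro k
        simp only [z, Finset.sum_mul, ite_mul, zero_mul, he.mul_eq]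
        rw [Finset.sum_eq_single k (fun l _ hl => by simp [hl]) (by simp)]
        simp
      have hez : ∀ k, e k * z = if link i k then e k else 0 := by
        intro k
        simp only [z, Finset.mul_sum, mul_ite, mul_zero, he.mul_eq]
        rw [Finset.sum_eq_single k (fun l _ hl => by simp [hl.symm]) (by simp)]
        simp
      have hzB : z ∈ B := sum_mem fun k _ => by
        split_ifs
        exacts [heB k, zero_mem B]
      have hzcenter : z ∈ centerIn B := by
        refine mem_centerIn.2 ⟨hzB, fun b hb => ?_⟩
        have hblock : ∀ k l, e k * (b * z) * e l = e k * (z * b) * e l := by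
          intro k l
          rw [← mul_assoc, ← mul_assoc, mul_assoc (e k * b), hze, hez]
          by_cases hkl : e k * b * e l = 0
          · split_ifs <;> simp [hkl]
          · have hlink : link k l := ⟨e k * b * e l, mul_mem (mul_mem (heB k) hb) (heB l),
              by simp only [← mul_assoc, hidem], by simp only [mul_assoc, hidem], hkl⟩
            have hiff : link i k ↔ link i l :=
              ⟨fun h => link_trans h hlink, fun h => link_trans h (link_symm hlink)⟩
            by_cases hk : link i k
            · rw [if_pos hk, if_pos (hiff.1 hk)]
            · rw [if_neg hk, if_neg (mt hiff.2 hk)]; simp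
        have hsum : ∀ a : Matrix ι ι ℂ, a = ∑ k, ∑ l, e k * a * e l := fun a => by
          simp only [← Finset.mul_sum, he.complete, mul_one, ← Finset.sum_mul, one_mul]
        rw [hsum (b * z), hsum (z * b)]
        simp only [hblock]
      rw [← hZ] at hzcenter
      have h1 : z * y = y := by
        rw [← hy1, ← mul_assoc, hze, if_pos (link_refl i)]
      have h2 : y * z = 0 := by
        rw [← hy2, mul_assoc, hez, if_neg hij, mul_zero]
      rw [← h1, ← (mem_centerIn.1 hzcenter).2 y hyA, h2]
      exact zero_mem B
  refine le_antisymm hBA fun x hx => ?_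
  have hsum : x = ∑ k, ∑ l, e k * x * e l := by
    simp only [← Finset.mul_sum, he.complete, mul_one, ← Finset.sum_mul, one_mul]
  rw [hsum]
  exact sum_mem fun k _ => sum_mem fun l _ => hpiece x hx k l

/-- A strictly decreasing chain of unital star subalgebras of `M_d` has at most `2d - 2` steps. -/
theorem length_le_of_strictAnti_starSubalgebra [Nonempty ι]
    {A : ℕ → StarSubalgebra ℂ (Matrix ι ι ℂ)} {m : ℕ}
    (hA : ∀ n < m, A (n + 1) < A n) : m ≤ 2 * Fintype.card ι - 2 := by
  have key : ∀ n ≤ m, 2 * abelianRank (A n) + Module.finrank ℂ (centerIn (A 0)) + n ≤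
      2 * abelianRank (A 0) + Module.finrank ℂ (centerIn (A n)) := by
    intro n
    induction n with
    | zero => simp
    | succ n ih =>
      intro hn
      have h := hA n hn
      have h1 := ih (by lia)
      have h2 := abelianRank_mono h.le
      have h3 := abelianRank_add_finrank_centerIn_le h.le
      have h4 : ¬(abelianRank (A n) ≤ abelianRank (A (n + 1)) ∧
          Module.finrank ℂ (centerIn (A (n + 1))) ≤ Module.finrank ℂ (centerIn (A n))) :=
        fun h' => h.ne (eq_of_abelianRank_le_of_finrank_centerIn_le h.le h'.1 h'.2)
      lia
  have h1 := key m le_rfl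
  have h2 := (isAbelianIn_centerIn (A m)).finrank_le
  have h3 := abelianRank_le_card (A 0)
  have h4 := finrank_centerIn_pos (A 0)
  have h5 := finrank_centerIn_pos (A m)
  lia

end StarSubalgebras

section Channels

open scoped Matrix

variable {ι : Type*} {E F : Module.End ℂ (Matrix ι ι ℂ)}

theorem IsQuantumChannel.one [Fintype ι] : IsQuantumChannel (1 : Module.End ℂ (Matrix ι ι ℂ)) :=
  ⟨fun _ _ hA => hA, fun _ => rfl⟩

theorem IsQuantumChannel.mul [Fintype ι] (hE : IsQuantumChannel E) (hF : IsQuantumChannel F) :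
    IsQuantumChannel (E * F) :=
  ⟨fun n A hA => hE.1 n _ (hF.1 n A hA), fun x => (hE.2 (F x)).trans (hF.2 x)⟩

theorem IsQuantumChannel.pow [Fintype ι] (hE : IsQuantumChannel E) (n : ℕ) :
    IsQuantumChannel (E ^ n) := by
  induction n with
  | zero => exact IsQuantumChannel.one
  | succ n ih => exact pow_succ E n ▸ ih.mul hE

theorem pow_apply_one [DecidableEq ι] (hu : E 1 = 1) (n : ℕ) : (E ^ n) 1 = 1 := by
  induction n with
  | zero => rfl
  | succ n ih => rw [pow_succ, Module.End.mul_apply, hu, ih]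

variable [Fintype ι]

theorem eq_zero_of_posSemidef_add_smul {R H : Matrix ι ι ℂ}
    (h : ∀ s : ℝ, (R + (s : ℂ) • H).PosSemidef) : H = 0 := by
  have hquad : ∀ v : ι → ℂ, star v ⬝ᵥ H *ᵥ v = 0 := by
    intro v
    have hv : ∀ s : ℝ, 0 ≤ star v ⬝ᵥ R *ᵥ v + s * (star v ⬝ᵥ H *ᵥ v) := fun s => by
      simpa [Matrix.add_mulVec, Matrix.smul_mulVec, dotProduct_add, dotProduct_smul] using
        (h s).dotProduct_mulVec_nonneg v
    generalize star v ⬝ᵥ R *ᵥ v = r at hv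
    generalize star v ⬝ᵥ H *ᵥ v = t at hv
    have hre : ∀ s : ℝ, 0 ≤ r.re + s * t.re := fun s => by
      simpa using (Complex.nonneg_iff.1 (hv s)).1
    have him : ∀ s : ℝ, 0 = r.im + s * t.im := fun s => by
      simpa using (Complex.nonneg_iff.1 (hv s)).2
    refine Complex.ext ?_ ?_
    · by_contra h0
      have h1 := hre ((-r.re - 1) / t.re)
      rw [div_mul_cancel₀ _ h0] at h1
      linarith
    · have h0 := him 0
      have h1 := him 1
      simp only [Complex.zero_im]
      linarith
  have hherm : H.IsHermitian := by
    simpa using (h 1).1.sub (h 0).1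
  have hpos : H.PosSemidef := .of_dotProduct_mulVec_nonneg hherm fun v => (hquad v).ge
  have hneg : (-H).PosSemidef := .of_dotProduct_mulVec_nonneg hherm.neg fun v => by
    simp [Matrix.neg_mulVec, hquad v]
  refine hpos.trace_eq_zero_iff.1 (le_antisymm ?_ hpos.trace_nonneg)
  simpa using hneg.trace_nonneg

variable [DecidableEq ι]

/-- The matrix with blocks `xᴴ x, xᴴ, x, 1`. -/
def schwarzBlock (x : Matrix ι ι ℂ) : Matrix (Fin 2 × ι) (Fin 2 × ι) ℂ :=
  Matrix.of fun p q => ((![x, 1] p.1)ᴴ * ![x, 1] q.1) p.2 q.2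

theorem posSemidef_schwarzBlock (x : Matrix ι ι ℂ) : (schwarzBlock x).PosSemidef := by
  let R : Matrix ι (Fin 2 × ι) ℂ := Matrix.of fun a q => ![x, 1] q.1 a q.2
  have h : schwarzBlock x = Rᴴ * R := by
    ext p q
    simp [schwarzBlock, R, Matrix.mul_apply]
  exact h ▸ Matrix.posSemidef_conjTranspose_mul_self R

theorem ampl_schwarzBlock_apply (E : Module.End ℂ (Matrix ι ι ℂ)) (x : Matrix ι ι ℂ) (i j : Fin 2)
    (a b : ι) : ampl 2 E (schwarzBlock x) (i, a) (j, b) = E ((![x, 1] i)ᴴ * ![x, 1] j) a b :=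
  rfl

theorem IsQuantumChannel.map_conjTranspose (hE : IsQuantumChannel E) (x : Matrix ι ι ℂ) :
    E xᴴ = (E x)ᴴ := by
  ext a b
  have h := (hE.1 2 _ (posSemidef_schwarzBlock x)).1.apply (0, a) (1, b)
  rw [ampl_schwarzBlock_apply, ampl_schwarzBlock_apply] at h
  simpa using h.symm

/-- The Kadison-Schwarz inequality. -/
theorem IsQuantumChannel.posSemidef_sub (hE : IsQuantumChannel E) (hu : E 1 = 1)
    (x : Matrix ι ι ℂ) : (E (xᴴ * x) - (E x)ᴴ * E x).PosSemidef := by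
  let V : Matrix (Fin 2 × ι) ι ℂ := Matrix.of fun p b => ![1, -E x] p.1 p.2 b
  have h := (hE.1 2 _ (posSemidef_schwarzBlock x)).conjTranspose_mul_mul_same V
  convert h using 1
  have hV : ampl 2 E (schwarzBlock x) * V =
      Matrix.of fun p b => ![E (xᴴ * x) - (E x)ᴴ * E x, 0] p.1 p.2 b := by
    ext ⟨i, a⟩ b
    fin_cases i <;>
      simp [Matrix.mul_apply, Fintype.sum_prod_type, ampl_schwarzBlock_apply, V, hu,
        hE.map_conjTranspose, Matrix.one_apply, sub_eq_add_neg]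
  rw [Matrix.mul_assoc, hV]
  ext a b
  simp [Matrix.mul_apply, Fintype.sum_prod_type, V, Matrix.one_apply]

theorem IsQuantumChannel.trace_le (hE : IsQuantumChannel E) (hu : E 1 = 1) (x : Matrix ι ι ℂ) :
    ((E x)ᴴ * E x).trace ≤ (xᴴ * x).trace := by
  have h := (hE.posSemidef_sub hu x).trace_nonneg
  rwa [Matrix.trace_sub, hE.2, sub_nonneg] at h

theorem IsQuantumChannel.map_conjTranspose_mul_self (hE : IsQuantumChannel E) (hu : E 1 = 1)
    {x : Matrix ι ι ℂ} (hx : ((E x)ᴴ * E x).trace = (xᴴ * x).trace) :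
    E (xᴴ * x) = (E x)ᴴ * E x := by
  refine sub_eq_zero.1 ((hE.posSemidef_sub hu x).trace_eq_zero_iff.1 ?_)
  rw [Matrix.trace_sub, hE.2, hx, sub_self]

/-- If the sesquilinear defect of `E` vanishes at `(x, x)`, it vanishes at every `(x, y)`. -/
theorem IsQuantumChannel.map_conjTranspose_mul (hE : IsQuantumChannel E) (hu : E 1 = 1)
    {x : Matrix ι ι ℂ} (hx : E (xᴴ * x) = (E x)ᴴ * E x) (y : Matrix ι ι ℂ) :
    E (xᴴ * y) = (E x)ᴴ * E y := by
  have key : ∀ z : Matrix ι ι ℂ, E (zᴴ * z) = (E z)ᴴ * E z →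
      (E (zᴴ * y) - (E z)ᴴ * E y) + (E (yᴴ * z) - (E y)ᴴ * E z) = 0 := by
    intro z hz
    refine eq_zero_of_posSemidef_add_smul (R := E (yᴴ * y) - (E y)ᴴ * E y) fun s => ?_
    convert hE.posSemidef_sub hu (y + (s : ℂ) • z) using 1
    simp [add_mul, mul_add, hz, smul_sub, smul_add]
    abel
  have h1 := key x hx
  have h2 := key (Complex.I • x) (by simp [hx])
  have h3 : Complex.I • ((E (yᴴ * x) - (E y)ᴴ * E x) - (E (xᴴ * y) - (E x)ᴴ * E y)) = 0 := by
    rw [← h2]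
    simp [smul_sub]
    abel
  have h4 := sub_eq_zero.1 ((smul_eq_zero_iff_right Complex.I_ne_zero).1 h3)
  rw [h4, ← two_smul ℂ] at h1
  exact sub_eq_zero.1 ((smul_eq_zero_iff_right two_ne_zero).1 h1)

theorem IsQuantumChannel.mem_multDomain_iff (hE : IsQuantumChannel E) (hu : E 1 = 1)
    {x : Matrix ι ι ℂ} :
    x ∈ multDomain E ↔ ((E x)ᴴ * E x).trace = (xᴴ * x).trace := by
  refine ⟨fun h => ?_, fun h y => ?_⟩
  · rw [← hE.map_conjTranspose, ← (h xᴴ).2, hE.2]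
  · have h' : ((E xᴴ)ᴴ * E xᴴ).trace = (xᴴᴴ * xᴴ).trace := by
      rw [hE.map_conjTranspose, Matrix.conjTranspose_conjTranspose,
        Matrix.conjTranspose_conjTranspose, Matrix.trace_mul_comm, h, Matrix.trace_mul_comm]
    constructor
    · simpa [hE.map_conjTranspose] using
        hE.map_conjTranspose_mul hu (hE.map_conjTranspose_mul_self hu h') y
    · have h2 := hE.map_conjTranspose_mul hu (hE.map_conjTranspose_mul_self hu h) yᴴ
      simpa [hE.map_conjTranspose, ← Matrix.conjTranspose_mul] using congrArg Matrix.conjTranspose h2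

/-- The multiplicative domain of a unital channel as a star subalgebra. -/
def multDomainStarSubalgebra (hE : IsQuantumChannel E) (hu : E 1 = 1) :
    StarSubalgebra ℂ (Matrix ι ι ℂ) where
  carrier := multDomain E
  mul_mem' {a b} ha hb y := by
    constructor
    · rw [mul_assoc, (ha _).1, (hb _).1, (ha b).1, mul_assoc]
    · rw [← mul_assoc, (hb _).2, (ha _).2, (ha b).1, mul_assoc]
  add_mem' {a b} ha hb y := by
    simp [add_mul, mul_add, (ha y).1, (ha y).2, (hb y).1, (hb y).2]
  algebraMap_mem' r y := by
    simp [Algebra.algebraMap_eq_smul_one, hu]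
  star_mem' {a} ha := by
    rw [hE.mem_multDomain_iff hu] at ha ⊢
    rw [Matrix.star_eq_conjTranspose, hE.map_conjTranspose, Matrix.conjTranspose_conjTranspose,
      Matrix.conjTranspose_conjTranspose, Matrix.trace_mul_comm, ha, Matrix.trace_mul_comm]

theorem IsQuantumChannel.mem_multDomain_mul_iff (hE : IsQuantumChannel E) (hF : IsQuantumChannel F)
    (hEu : E 1 = 1) (hFu : F 1 = 1) {x : Matrix ι ι ℂ} :
    x ∈ multDomain (E * F) ↔ x ∈ multDomain F ∧ F x ∈ multDomain E := by
  have hu : (E * F) 1 = 1 := by rw [Module.End.mul_apply, hFu, hEu]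
  rw [(hE.mul hF).mem_multDomain_iff hu, hF.mem_multDomain_iff hFu, hE.mem_multDomain_iff hEu,
    Module.End.mul_apply]
  have h1 := hE.trace_le hEu (F x)
  have h2 := hF.trace_le hFu x
  refine ⟨fun h => ?_, fun h => h.2.trans h.1⟩
  have h3 := le_antisymm h2 (h ▸ h1)
  exact ⟨h3, h.trans h3.symm⟩

theorem IsQuantumChannel.multDomain_pow_succ_subset (hE : IsQuantumChannel E) (hu : E 1 = 1)
    (n : ℕ) : multDomain (E ^ (n + 1)) ⊆ multDomain (E ^ n) := fun x hx => by
  rw [pow_succ', hE.mem_multDomain_mul_iff (hE.pow n) hu (pow_apply_one hu n)] at hx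
  exact hx.1

theorem IsQuantumChannel.multDomain_pow_eq (hE : IsQuantumChannel E) (hu : E 1 = 1) {n : ℕ}
    (hn : multDomain (E ^ (n + 1)) = multDomain (E ^ n)) {m : ℕ} (hm : n ≤ m) :
    multDomain (E ^ m) = multDomain (E ^ n) := by
  have mem_succ_iff : ∀ k x, x ∈ multDomain (E ^ (k + 1)) ↔
      x ∈ multDomain E ∧ E x ∈ multDomain (E ^ k) := fun k x => by
    rw [pow_succ, (hE.pow k).mem_multDomain_mul_iff hE (pow_apply_one hu k) hu]
  have step : ∀ k, n ≤ k → multDomain (E ^ (k + 1)) = multDomain (E ^ k) := by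
    intro k hk
    induction k, hk using Nat.le_induction with
    | base => exact hn
    | succ k _ ih =>
      ext x
      rw [mem_succ_iff (k + 1), ih, ← mem_succ_iff k, ih]
  induction m, hm using Nat.le_induction with
  | base => rfl
  | succ m hm ih => rw [step m hm, ih]

theorem IsQuantumChannel.exists_multDomain_pow_succ_eq [Nonempty ι] (hE : IsQuantumChannel E)
    (hu : E 1 = 1) :
    ∃ n ≤ 2 * Fintype.card ι - 2, multDomain (E ^ (n + 1)) = multDomain (E ^ n) := by
  by_contra! h
  have := length_le_of_strictAnti_starSubalgebra (m := 2 * Fintype.card ι - 2 + 1)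
    (A := fun n => multDomainStarSubalgebra (hE.pow n) (pow_apply_one hu n)) fun n hn =>
      lt_of_le_of_ne (hE.multDomain_pow_succ_subset hu n)
        fun heq => h n (by lia) (congrArg SetLike.coe heq)
  lia

end Channels

/-- A unital quantum channel on `M_d` (`d ≥ 2`) has multiplicative
index at most `2d - 2`. -/
theorem stmt12 (d : ℕ) (hd : 2 ≤ d)
    (E : Module.End ℂ (Matrix (Fin d) (Fin d) ℂ))
    (hE : IsQuantumChannel E) (hu : E 1 = 1) :
    multIndex E ≤ 2 * d - 2 := by
  have : Nonempty (Fin d) := ⟨⟨0, by lia⟩⟩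
  obtain ⟨n, hn, heq⟩ := hE.exists_multDomain_pow_succ_eq hu
  rw [Fintype.card_fin] at hn
  refine Nat.sInf_le ⟨by lia, fun m hm => ?_⟩
  rw [hE.multDomain_pow_eq hu heq (hn.trans hm), hE.multDomain_pow_eq hu heq hn]
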